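/- Let G be an abelian group, Q a commutative (additive) monoid, w : Q → G a monoid homomorphism, and P = w⁻¹(0) the kernel submonoid. Let O be a commutative ring, and consider the monoid algebras O[P] ⊆ O[Q]. Then for every ideal I of O[P], the contraction of its extension is itself: (I · O[Q]) ∩ O[P] = I. -/

import Mathlib

theorem stmt7_inj {G : Type*} [AddCommGroup G] {Q : Type*} [AddCommMonoid Q]
    (w : Q →+ G) : Function.Injective (AddMonoidHom.mker w).subtype :=
  Subtype.val_injective

theorem stmt7_single {G : Type*} [AddCommGroup G] {Q : Type*} [AddCommMonoid Q]
    (w : Q →+ G) {O : Type*} [CommRing O] (q : Q) (s : O)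
    (hq : q ∉ Set.range (AddMonoidHom.mker w).subtype) :
    AddMonoidAlgebra.comapDomain (AddMonoidHom.mker w).subtype (stmt7_inj w)
      (AddMonoidAlgebra.single q s) = 0 := by
  ext x
  have : q ≠ x.1 := fun h => hq ⟨x, h.symm⟩
  simp [this]

theorem stmt7_proj {G : Type*} [AddCommGroup G] {Q : Type*} [AddCommMonoid Q]
    (w : Q →+ G) {O : Type*} [CommRing O] (c : AddMonoidAlgebra O Q)
    (g : AddMonoidAlgebra O (AddMonoidHom.mker w)) :
    AddMonoidAlgebra.comapDomain (AddMonoidHom.mker w).subtype (stmt7_inj w)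
      (c * AddMonoidAlgebra.mapDomainRingHom O (AddMonoidHom.mker w).subtype g) =
    AddMonoidAlgebra.comapDomain (AddMonoidHom.mker w).subtype (stmt7_inj w) c * g := by
  induction g using AddMonoidAlgebra.induction_linear with
  | zero => simp
  | add f g hf hg => rw [map_add, mul_add, AddMonoidAlgebra.comapDomain_add, hf, hg, mul_add]
  | single p r =>
    induction c using AddMonoidAlgebra.induction_linear with
    | zero => simp
    | add f g hf hg =>
      rw [add_mul, AddMonoidAlgebra.comapDomain_add, hf, hg, AddMonoidAlgebra.comapDomain_add,
        add_mul]
    | single q s =>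
      have hp : w p.1 = 0 := p.2
      have e : AddMonoidAlgebra.mapDomainRingHom O (AddMonoidHom.mker w).subtype
          (AddMonoidAlgebra.single p r) = AddMonoidAlgebra.single p.1 r := by simp
      rw [e, AddMonoidAlgebra.single_mul_single]
      by_cases hq : w q = 0
      · have h1 := AddMonoidAlgebra.comapDomain_single_map (AddMonoidHom.mker w).subtype
          (stmt7_inj w) ((⟨q, hq⟩ : AddMonoidHom.mker w) + p) (s * r)
        have h2 := AddMonoidAlgebra.comapDomain_single_map (AddMonoidHom.mker w).subtype
          (stmt7_inj w) (⟨q, hq⟩ : AddMonoidHom.mker w) s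
        refine h1.trans ?_
        rw [← AddMonoidAlgebra.single_mul_single]
        exact congrArg (· * _) h2.symm
      · rw [stmt7_single,
          stmt7_single, zero_mul]
        · rintro ⟨x, rfl⟩
          exact hq x.2
        · rintro ⟨x, hx⟩
          have h3 : w x.1 = 0 := x.2
          have h4 : x.1 = q + p.1 := hx
          rw [h4, map_add, hp, add_zero] at h3
          exact hq h3


/-- Let `w : Q →+ G` be a homomorphism to an abelian group with kernel submonoid `P`.
Then for the induced inclusion of monoid algebras `O[P] → O[Q]`, every ideal of `O[P]`
is the contraction of its extension. -/
theorem stmt7 (G : Type*) [AddCommGroup G] (Q : Type*) [AddCommMonoid Q]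
    (w : Q →+ G) (O : Type*) [CommRing O]
    (I : Ideal (AddMonoidAlgebra O (AddMonoidHom.mker w))) :
    Ideal.comap (AddMonoidAlgebra.mapDomainRingHom O (AddMonoidHom.mker w).subtype)
      (Ideal.map (AddMonoidAlgebra.mapDomainRingHom O (AddMonoidHom.mker w).subtype) I) = I := by
  refine le_antisymm ?_ Ideal.le_comap_map
  intro u hu
  rw [Ideal.mem_comap] at hu
  have key : ∀ x ∈ Ideal.map
      (AddMonoidAlgebra.mapDomainRingHom O (AddMonoidHom.mker w).subtype) I,
      AddMonoidAlgebra.comapDomain (AddMonoidHom.mker w).subtype (stmt7_inj w) x ∈ I := by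
    intro x hx
    refine Submodule.span_induction (p := fun x _ => ∀ c : AddMonoidAlgebra O Q,
      AddMonoidAlgebra.comapDomain (AddMonoidHom.mker w).subtype (stmt7_inj w)
        (c * x) ∈ I) ?_ ?_ ?_ ?_ hx 1 |> fun h => by rwa [one_mul] at h
    · rintro _ ⟨g, hg, rfl⟩ c
      have := stmt7_proj w c g
      exact this ▸ I.mul_mem_left _ hg
    · intro c
      simp
    · intro x y _ _ h1 h2 c
      rw [mul_add, AddMonoidAlgebra.comapDomain_add]
      exact I.add_mem (h1 c) (h2 c)
    · intro a x _ h c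
      rw [smul_eq_mul, ← mul_assoc]
      exact h _
  have h := key _ hu
  have h1 := stmt7_proj w 1 u
  rw [one_mul] at h1
  have h2 : AddMonoidAlgebra.comapDomain (AddMonoidHom.mker w).subtype (stmt7_inj w)
      (1 : AddMonoidAlgebra O Q) = 1 :=
    AddMonoidAlgebra.comapDomain_single_map (AddMonoidHom.mker w).subtype
      (stmt7_inj w) (0 : AddMonoidHom.mker w) (1 : O)
  rw [h2, one_mul] at h1
  rwa [h1] at h
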